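/- For every real ε > 0, the set of integer-valued polynomials P satisfying ∑_{n=0}^∞ (1/(n+1))·|P(n)|²·φ^{−2n} ≤ 2/π + ε is infinite. -/

import Mathlib

/-- The golden ratio `(1 + √5)/2`. -/
noncomputable def phi : ℝ := (1 + Real.sqrt 5) / 2

/-- A real polynomial is integer-valued if it sends every integer to an integer. -/
def IsIVP (P : Polynomial ℝ) : Prop := ∀ n : ℤ, ∃ m : ℤ, P.eval (n : ℝ) = (m : ℝ)

section PairingOfPowerSeries

open PowerSeries

/-- The pairing `∑ fₘ gₘ` of two real power series. -/
noncomputable def coeffPairing (f g : ℝ⟦X⟧) : ℝ := ∑' m, coeff m f * coeff m g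

/-- The real power series whose coefficients are absolutely summable. -/
def absSummableSubring : Subring ℝ⟦X⟧ where
  carrier := {f | Summable fun m => ‖coeff m f‖}
  mul_mem' {f g} hf hg := by
    simpa only [Set.mem_ofPred_eq, coeff_mul] using
      summable_norm_sum_mul_antidiagonal_of_summable_norm hf hg
  one_mem' := summable_of_ne_finset_zero (s := {0}) fun m hm => by
    simp only [Finset.mem_singleton] at hm
    simp [coeff_one, hm]
  add_mem' {f g} hf hg := by
    refine Summable.of_nonneg_of_le (fun _ => norm_nonneg _) (fun m => ?_) (Summable.add hf hg)
    simpa using norm_add_le (coeff m f) (coeff m g)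
  zero_mem' := by simp [summable_zero]
  neg_mem' {f} hf := by simpa using hf

lemma mem_absSummableSubring {f : ℝ⟦X⟧} :
    f ∈ absSummableSubring ↔ Summable fun m => ‖coeff m f‖ := Iff.rfl

lemma X_mem_absSummableSubring : (X : ℝ⟦X⟧) ∈ absSummableSubring :=
  summable_of_ne_finset_zero (s := {1}) fun m hm => by
    simp only [Finset.mem_singleton] at hm
    simp [coeff_X, hm]

lemma C_mem_absSummableSubring (a : ℝ) : (C a : ℝ⟦X⟧) ∈ absSummableSubring :=
  summable_of_ne_finset_zero (s := {0}) fun m hm => by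
    simp only [Finset.mem_singleton] at hm
    simp [coeff_C, hm]

lemma summable_coeff_mul_coeff {f g : ℝ⟦X⟧} (hf : f ∈ absSummableSubring)
    (hg : g ∈ absSummableSubring) : Summable fun m => coeff m f * coeff m g :=
  (summable_mul_of_summable_norm' hf (Summable.of_norm hf) hg (Summable.of_norm hg)).comp_injective
    (i := fun m : ℕ => (m, m)) fun _ _ h => (Prod.mk.inj h).1

lemma coeffPairing_comm (f g : ℝ⟦X⟧) : coeffPairing f g = coeffPairing g f := by
  simp only [coeffPairing, mul_comm]

lemma coeffPairing_add_left {f f' g : ℝ⟦X⟧} (hf : f ∈ absSummableSubring)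
    (hf' : f' ∈ absSummableSubring) (hg : g ∈ absSummableSubring) :
    coeffPairing (f + f') g = coeffPairing f g + coeffPairing f' g := by
  simp only [coeffPairing, map_add, add_mul]
  exact (summable_coeff_mul_coeff hf hg).tsum_add (summable_coeff_mul_coeff hf' hg)

lemma coeffPairing_C_mul_left (a : ℝ) (f g : ℝ⟦X⟧) :
    coeffPairing (C a * f) g = a * coeffPairing f g := by
  simp only [coeffPairing, coeff_C_mul, mul_assoc, tsum_mul_left]

lemma coeffPairing_C_mul_right (a : ℝ) (f g : ℝ⟦X⟧) :
    coeffPairing f (C a * g) = a * coeffPairing f g := by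
  rw [coeffPairing_comm, coeffPairing_C_mul_left, coeffPairing_comm]

lemma coeffPairing_sub_left {f f' g : ℝ⟦X⟧} (hf : f ∈ absSummableSubring)
    (hf' : f' ∈ absSummableSubring) (hg : g ∈ absSummableSubring) :
    coeffPairing (f - f') g = coeffPairing f g - coeffPairing f' g := by
  simp only [coeffPairing, map_sub, sub_mul]
  exact (summable_coeff_mul_coeff hf hg).tsum_sub (summable_coeff_mul_coeff hf' hg)

lemma coeffPairing_sub_right {f g g' : ℝ⟦X⟧} (hf : f ∈ absSummableSubring)
    (hg : g ∈ absSummableSubring) (hg' : g' ∈ absSummableSubring) :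
    coeffPairing f (g - g') = coeffPairing f g - coeffPairing f g' := by
  rw [coeffPairing_comm, coeffPairing_sub_left hg hg' hf, coeffPairing_comm g,
    coeffPairing_comm g']

lemma coeffPairing_sum_sum {ι κ : Type*} (s : Finset ι) (t : Finset κ) {f : ι → ℝ⟦X⟧}
    {g : κ → ℝ⟦X⟧} (hf : ∀ i ∈ s, f i ∈ absSummableSubring)
    (hg : ∀ j ∈ t, g j ∈ absSummableSubring) :
    coeffPairing (∑ i ∈ s, f i) (∑ j ∈ t, g j) = ∑ i ∈ s, ∑ j ∈ t, coeffPairing (f i) (g j) := by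
  simp only [coeffPairing, map_sum, Finset.sum_mul_sum]
  rw [Summable.tsum_finsetSum fun i hi =>
    summable_sum fun j hj => summable_coeff_mul_coeff (hf i hi) (hg j hj)]
  exact Finset.sum_congr rfl fun i hi =>
    Summable.tsum_finsetSum fun j hj => summable_coeff_mul_coeff (hf i hi) (hg j hj)

lemma coeffPairing_X_mul_X_mul {f g : ℝ⟦X⟧} (hf : f ∈ absSummableSubring)
    (hg : g ∈ absSummableSubring) : coeffPairing (X * f) (X * g) = coeffPairing f g := by
  have hX := X_mem_absSummableSubring
  rw [coeffPairing,
    (summable_coeff_mul_coeff (mul_mem hX hf) (mul_mem hX hg)).tsum_eq_zero_add]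
  simp [coeffPairing, coeff_succ_X_mul]

/-- Pairing with a multiple of `X` on the left only sees the shifted series on the right. -/
lemma coeffPairing_X_mul_left {f g g' : ℝ⟦X⟧} (hf : f ∈ absSummableSubring)
    (hg : g ∈ absSummableSubring) (h : ∀ m, coeff (m + 1) g = coeff m g') :
    coeffPairing (X * f) g = coeffPairing f g' := by
  rw [coeffPairing, (summable_coeff_mul_coeff (mul_mem X_mem_absSummableSubring hf)
    hg).tsum_eq_zero_add]
  simp [coeffPairing, coeff_succ_X_mul, h]

end PairingOfPowerSeries

section BlaschkeSeries

open PowerSeries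

/-- The geometric series `1 / (1 - r X)`. -/
noncomputable def geomSeries (r : ℝ) : ℝ⟦X⟧ := rescale r (mk 1)

/-- The Blaschke factor `(X - r) / (1 - r X)` as a power series. -/
noncomputable def blaschkeSeries (r : ℝ) : ℝ⟦X⟧ := (X - C r) * geomSeries r

variable {r : ℝ}

lemma coeff_geomSeries (m : ℕ) : coeff m (geomSeries r) = r ^ m := by
  simp [geomSeries, coeff_rescale]

lemma one_sub_mul_geomSeries : (1 - C r * X) * geomSeries r = 1 := by
  have h := congrArg (rescale r) (mk_one_mul_one_sub_eq_one ℝ)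
  rwa [map_mul, map_sub, map_one, rescale_X, mul_comm] at h

lemma derivative_geomSeries : derivative ℝ (geomSeries r) = C r * geomSeries r ^ 2 := by
  have h := congrArg (derivative ℝ) (one_sub_mul_geomSeries (r := r))
  simp only [Derivation.leibniz, map_sub, derivative_one, derivative_C, derivative_X, smul_eq_mul]
    at h
  linear_combination geomSeries r * h - derivative ℝ (geomSeries r) * one_sub_mul_geomSeries (r := r)

lemma derivative_blaschkeSeries :
    derivative ℝ (blaschkeSeries r) = C (1 - r ^ 2) * geomSeries r ^ 2 := by
  simp only [blaschkeSeries, Derivation.leibniz, map_sub, derivative_C, derivative_X, smul_eq_mul,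
    derivative_geomSeries, map_one, map_pow]
  linear_combination (-geomSeries r) * one_sub_mul_geomSeries (r := r)

lemma geomSeries_mem (h : |r| < 1) : geomSeries r ∈ absSummableSubring := by
  simpa [mem_absSummableSubring, coeff_geomSeries] using summable_geometric_of_lt_one
    (abs_nonneg r) h

lemma blaschkeSeries_mem (h : |r| < 1) : blaschkeSeries r ∈ absSummableSubring :=
  mul_mem (sub_mem X_mem_absSummableSubring (C_mem_absSummableSubring r)) (geomSeries_mem h)

/-- Multiplication by a Blaschke factor is an isometry. -/
lemma coeffPairing_blaschkeSeries_mul (h : |r| < 1) {f g : ℝ⟦X⟧} (hf : f ∈ absSummableSubring)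
    (hg : g ∈ absSummableSubring) :
    coeffPairing (blaschkeSeries r * f) (blaschkeSeries r * g) = coeffPairing f g := by
  have key : ∀ {u v : ℝ⟦X⟧}, u ∈ absSummableSubring → v ∈ absSummableSubring →
      coeffPairing (X * u - C r * u) (X * v - C r * v) =
        coeffPairing (u - C r * (X * u)) (v - C r * (X * v)) := by
    intro u v hu hv
    have hX := X_mem_absSummableSubring
    have hC := C_mem_absSummableSubring r
    have hXu := mul_mem hX hu
    have hXv := mul_mem hX hv
    rw [coeffPairing_sub_left hXu (mul_mem hC hu) (sub_mem hXv (mul_mem hC hv)),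
      coeffPairing_sub_right hXu hXv (mul_mem hC hv),
      coeffPairing_sub_right (mul_mem hC hu) hXv (mul_mem hC hv),
      coeffPairing_sub_left hu (mul_mem hC hXu) (sub_mem hv (mul_mem hC hXv)),
      coeffPairing_sub_right hu hv (mul_mem hC hXv),
      coeffPairing_sub_right (mul_mem hC hXu) hv (mul_mem hC hXv)]
    simp only [coeffPairing_C_mul_left, coeffPairing_C_mul_right, coeffPairing_X_mul_X_mul hu hv]
    ring
  have hE := geomSeries_mem h
  convert key (mul_mem hE hf) (mul_mem hE hg) using 2
  · rw [blaschkeSeries]; ring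
  · rw [blaschkeSeries]; ring
  · linear_combination (-f) * one_sub_mul_geomSeries (r := r)
  · linear_combination (-g) * one_sub_mul_geomSeries (r := r)

lemma coeffPairing_geomSeries_blaschkeSeries_mul (h : |r| < 1) {g : ℝ⟦X⟧}
    (hg : g ∈ absSummableSubring) : coeffPairing (geomSeries r) (blaschkeSeries r * g) = 0 := by
  have hE := geomSeries_mem h
  have hC := C_mem_absSummableSubring r
  have hEg := mul_mem hE hg
  have e : blaschkeSeries r * g = X * (geomSeries r * g) - C r * (geomSeries r * g) := by
    rw [blaschkeSeries]; ring
  rw [e, coeffPairing_sub_right hE (mul_mem X_mem_absSummableSubring hEg) (mul_mem hC hEg),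
    coeffPairing_C_mul_right, coeffPairing_comm,
    coeffPairing_X_mul_left (g' := C r * geomSeries r) hEg hE
      fun m => by simp [coeff_geomSeries, pow_succ'],
    coeffPairing_C_mul_right, coeffPairing_comm, sub_self]

lemma coeffPairing_geomSeries_self (h : |r| < 1) :
    coeffPairing (geomSeries r) (geomSeries r) = (1 - r ^ 2)⁻¹ := by
  have h2 : r ^ 2 < 1 := by rwa [sq_lt_one_iff_abs_lt_one]
  simp only [coeffPairing, coeff_geomSeries, ← sq, ← pow_mul']
  simp only [pow_mul]
  exact tsum_geometric_of_lt_one (sq_nonneg r) h2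

lemma coeff_geomSeries_sq (m : ℕ) :
    coeff m (geomSeries r ^ 2) = coeff m (C r * (X * geomSeries r ^ 2) + geomSeries r) := by
  congr 1
  linear_combination geomSeries r * one_sub_mul_geomSeries (r := r)

lemma coeffPairing_X_mul_geomSeries_sq (h : |r| < 1) {g : ℝ⟦X⟧} (hg : g ∈ absSummableSubring) :
    coeffPairing (X * geomSeries r ^ 2) (blaschkeSeries r * g) =
      coeffPairing (geomSeries r) (geomSeries r * g) := by
  have hE := geomSeries_mem h
  have hC := C_mem_absSummableSubring r
  have hX := X_mem_absSummableSubring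
  have hEg := mul_mem hE hg
  have hXE := mul_mem hX (pow_mem hE 2)
  have e : blaschkeSeries r * g = X * (geomSeries r * g) - C r * (geomSeries r * g) := by
    rw [blaschkeSeries]; ring
  rw [e, coeffPairing_sub_right hXE (mul_mem hX hEg) (mul_mem hC hEg),
    coeffPairing_C_mul_right, coeffPairing_comm,
    coeffPairing_X_mul_left (g' := C r * (X * geomSeries r ^ 2) + geomSeries r) hEg hXE
      fun m => by rw [coeff_succ_X_mul, coeff_geomSeries_sq],
    coeffPairing_comm, coeffPairing_add_left (mul_mem hC hXE) hE hEg, coeffPairing_C_mul_left]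
  ring

/-- The series `X` times the derivative of `Bⁿ⁺¹ / (n + 1)`, for the Blaschke factor `B`. -/
noncomputable def blaschkeDeriv (r : ℝ) (n : ℕ) : ℝ⟦X⟧ :=
  C (1 - r ^ 2) * (X * geomSeries r ^ 2 * blaschkeSeries r ^ n)

lemma blaschkeDeriv_mem (h : |r| < 1) (n : ℕ) : blaschkeDeriv r n ∈ absSummableSubring :=
  mul_mem (C_mem_absSummableSubring _) (mul_mem (mul_mem X_mem_absSummableSubring
    (pow_mem (geomSeries_mem h) 2)) (pow_mem (blaschkeSeries_mem h) n))

lemma natCast_mul_coeff_blaschkeSeries_pow (n m : ℕ) :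
    m * coeff m (blaschkeSeries r ^ (n + 1)) = (n + 1) * coeff m (blaschkeDeriv r n) := by
  have hd : X * derivative ℝ (blaschkeSeries r ^ (n + 1)) = C (n + 1 : ℝ) * blaschkeDeriv r n := by
    rw [derivative_pow, derivative_blaschkeSeries, blaschkeDeriv]
    simp only [Nat.add_sub_cancel, Nat.cast_add, Nat.cast_one, map_add, map_natCast, map_one]
    ring
  rw [← coeff_C_mul _ (blaschkeDeriv r n), ← hd]
  cases m with
  | zero => simp
  | succ m => rw [coeff_succ_X_mul, coeff_derivative]; push_cast; ring

lemma coeffPairing_blaschkeDeriv_of_le (h : |r| < 1) {i j : ℕ} (hij : i ≤ j) :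
    coeffPairing (blaschkeDeriv r i) (blaschkeSeries r ^ (j + 1)) = if i = j then 1 else 0 := by
  have hE := geomSeries_mem h
  have hB := blaschkeSeries_mem h
  have hX := X_mem_absSummableSubring
  have iso : ∀ (k : ℕ) {f g : ℝ⟦X⟧}, f ∈ absSummableSubring → g ∈ absSummableSubring →
      coeffPairing (blaschkeSeries r ^ k * f) (blaschkeSeries r ^ k * g) = coeffPairing f g := by
    intro k f g hf hg
    induction k with
    | zero => simp
    | succ k ih =>
      rw [pow_succ', mul_assoc, mul_assoc, coeffPairing_blaschkeSeries_mul h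
        (mul_mem (pow_mem hB k) hf) (mul_mem (pow_mem hB k) hg), ih]
  obtain ⟨l, rfl⟩ := Nat.exists_eq_add_of_le hij
  have e : blaschkeSeries r ^ (i + l + 1) =
      blaschkeSeries r ^ i * (blaschkeSeries r * blaschkeSeries r ^ l) := by ring
  rw [blaschkeDeriv, coeffPairing_C_mul_left, mul_comm _ (blaschkeSeries r ^ i), e,
    iso i (mul_mem hX (pow_mem hE 2)) (mul_mem hB (pow_mem hB l)),
    coeffPairing_X_mul_geomSeries_sq h (pow_mem hB l)]
  cases l with
  | zero =>
    have h2 : r ^ 2 < 1 := by rwa [sq_lt_one_iff_abs_lt_one]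
    simp [coeffPairing_geomSeries_self h, mul_inv_cancel₀ (sub_pos.2 h2).ne']
  | succ l =>
    rw [pow_succ' _ l, mul_left_comm (geomSeries r),
      coeffPairing_geomSeries_blaschkeSeries_mul h (mul_mem hE (pow_mem hB l))]
    simp

/-- The powers of a Blaschke factor are orthogonal for the Dirichlet inner product. -/
lemma coeffPairing_blaschkeDeriv (h : |r| < 1) (i j : ℕ) :
    coeffPairing (blaschkeDeriv r i) (blaschkeSeries r ^ (j + 1)) = if i = j then 1 else 0 := by
  rcases le_or_gt i j with hij | hij
  · exact coeffPairing_blaschkeDeriv_of_le h hij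
  · have symm : (i + 1) * coeffPairing (blaschkeDeriv r i) (blaschkeSeries r ^ (j + 1)) =
        (j + 1) * coeffPairing (blaschkeDeriv r j) (blaschkeSeries r ^ (i + 1)) := by
      simp only [coeffPairing, ← tsum_mul_left, ← mul_assoc,
        ← natCast_mul_coeff_blaschkeSeries_pow]
      exact tsum_congr fun m => by ring
    rw [coeffPairing_blaschkeDeriv_of_le h hij.le, if_neg hij.ne, mul_zero] at symm
    rw [if_neg hij.ne']
    exact (mul_eq_zero.1 symm).resolve_left (by positivity)

lemma sum_C_mul_blaschkeDeriv_mem (h : |r| < 1) {N : ℕ} (a : Fin N → ℝ) :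
    ∑ l, C (a l) * blaschkeDeriv r l ∈ absSummableSubring :=
  sum_mem fun l _ => mul_mem (C_mem_absSummableSubring _) (blaschkeDeriv_mem h l)

/-- A Bergman norm is bounded by the corresponding Dirichlet norm, which is diagonal in the
powers of a Blaschke factor. -/
lemma tsum_sq_coeff_div_le (h : |r| < 1) {N : ℕ} (a : Fin N → ℝ) :
    ∑' m : ℕ, coeff m (∑ l, C (a l) * blaschkeDeriv r l) ^ 2 / (m + 1) ≤
      ∑ l : Fin N, a l ^ 2 / ((l : ℕ) + 1) := by
  set f := ∑ l, C (a l) * blaschkeDeriv r l with hf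
  set g := ∑ l : Fin N, C (a l / ((l : ℕ) + 1)) * blaschkeSeries r ^ ((l : ℕ) + 1) with hg
  have hBmem : ∀ l : Fin N, C (a l / ((l : ℕ) + 1)) * blaschkeSeries r ^ ((l : ℕ) + 1) ∈
      absSummableSubring := fun l =>
    mul_mem (C_mem_absSummableSubring _) (pow_mem (blaschkeSeries_mem h) _)
  have hfmem : f ∈ absSummableSubring := sum_C_mul_blaschkeDeriv_mem h a
  have hgmem : g ∈ absSummableSubring := sum_mem fun l _ => hBmem l
  have hfg : ∀ m : ℕ, coeff m f = m * coeff m g := fun m => by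
    simp only [hf, hg, map_sum, coeff_C_mul, Finset.mul_sum]
    refine Finset.sum_congr rfl fun l _ => ?_
    have := natCast_mul_coeff_blaschkeSeries_pow (r := r) l m
    rw [mul_left_comm, this]
    field_simp
  have hpair : coeffPairing f g = ∑ l : Fin N, a l ^ 2 / ((l : ℕ) + 1) := by
    rw [hf, hg, coeffPairing_sum_sum (Finset.univ : Finset (Fin N)) Finset.univ
      (fun l _ => mul_mem (C_mem_absSummableSubring (a l)) (blaschkeDeriv_mem h l))
      fun l _ => hBmem l]
    simp only [coeffPairing_C_mul_left, coeffPairing_C_mul_right, coeffPairing_blaschkeDeriv h,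
      Fin.val_inj, mul_ite, mul_one, mul_zero, Finset.sum_ite_eq, Finset.mem_univ, if_true]
    exact Finset.sum_congr rfl fun l _ => by ring
  have hle : ∀ m : ℕ, coeff m f ^ 2 / (m + 1) ≤ coeff m f * coeff m g := fun m => by
    rw [div_le_iff₀ (by positivity), hfg]
    nlinarith [mul_nonneg (Nat.cast_nonneg (α := ℝ) m) (sq_nonneg (coeff m g))]
  rw [← hpair, coeffPairing]
  exact Summable.tsum_le_tsum hle (Summable.of_nonneg_of_le (fun m => by positivity) hle
    (summable_coeff_mul_coeff hfmem hgmem)) (summable_coeff_mul_coeff hfmem hgmem)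

end BlaschkeSeries

section Minkowski

open MeasureTheory Module

lemma exists_int_vector_sum_sq_mulVec_lt {N : ℕ} (A : Matrix (Fin N) (Fin N) ℝ) (hA : A.det ≠ 0)
    {ρ : ℝ} (hρ : 0 < ρ)
    (h : 2 ^ N * |A.det| < ρ ^ N * (√Real.pi ^ N / Real.Gamma (N / 2 + 1))) :
    ∃ z : Fin N → ℤ, z ≠ 0 ∧ ∑ i, (A.mulVec (fun j => (z j : ℝ)) i) ^ 2 < ρ ^ 2 := by
  have hN : Nonempty (Fin N) := by
    by_contra hN
    obtain rfl : N = 0 := by simpa [← Fin.pos_iff_nonempty] using hN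
    simp at h
  set T : (Fin N → ℝ) →ₗ[ℝ] EuclideanSpace ℝ (Fin N) :=
    (WithLp.linearEquiv 2 ℝ (Fin N → ℝ)).symm.toLinearMap ∘ₗ Matrix.toLin' A with hT
  set s : Set (Fin N → ℝ) := T ⁻¹' Metric.ball 0 ρ with hs
  have hdet : LinearMap.det (Matrix.toLin' A) = A.det := LinearMap.det_toLin' A
  have hvol : volume s = ENNReal.ofReal (|A.det|⁻¹ *
      (ρ ^ N * (√Real.pi ^ N / Real.Gamma (N / 2 + 1)))) := by
    have : s = Matrix.toLin' A ⁻¹'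
        (WithLp.toLp 2 ⁻¹' Metric.ball (0 : EuclideanSpace ℝ (Fin N)) ρ) := rfl
    rw [this, Measure.addHaar_preimage_linearMap _ (by rwa [hdet]),
      (PiLp.volume_preserving_toLp (Fin N)).measure_preimage
        Metric.isOpen_ball.measurableSet.nullMeasurableSet,
      EuclideanSpace.volume_ball, hdet, abs_inv, Fintype.card_fin, ← ENNReal.ofReal_pow hρ.le,
      ← ENNReal.ofReal_mul (by positivity), ← ENNReal.ofReal_mul (by positivity)]
  have hsymm : ∀ x ∈ s, -x ∈ s := fun x hx => by
    simpa [hs] using hx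
  have hconv : Convex ℝ s := (convex_ball _ _).linear_preimage T
  set b := Pi.basisFun ℝ (Fin N) with hb
  have hlt : volume (ZSpan.fundamentalDomain b) * 2 ^ finrank ℝ (Fin N → ℝ) < volume s := by
    have h1 : (Matrix.of b).det = 1 := by
      rw [show Matrix.of b = 1 by ext i j; simp [hb, Matrix.one_apply, Pi.single_apply, eq_comm]]
      exact Matrix.det_one
    rw [ZSpan.volume_fundamentalDomain, h1, hvol]
    simp only [abs_one, ENNReal.ofReal_one, one_mul, finrank_fin_fun]
    rw [show (2 : ENNReal) = ENNReal.ofReal 2 by simp, ← ENNReal.ofReal_pow (by norm_num)]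
    refine (ENNReal.ofReal_lt_ofReal_iff_of_nonneg (by positivity)).2 ?_
    rwa [lt_inv_mul_iff₀ (abs_pos.2 hA), mul_comm]
  have : Countable (Submodule.span ℤ (Set.range b)).toAddSubgroup :=
    inferInstanceAs (Countable (Submodule.span ℤ (Set.range b)))
  obtain ⟨x, hx0, hxs⟩ := exists_ne_zero_mem_lattice_of_measure_mul_two_pow_lt_measure
    (L := (Submodule.span ℤ (Set.range b)).toAddSubgroup)
    (ZSpan.isAddFundamentalDomain b volume) hsymm hconv hlt
  have hx := (b.mem_span_iff_repr_mem ℤ (x : Fin N → ℝ)).1 x.2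
  choose z hz using hx
  have hzx : (fun j => (z j : ℝ)) = (x : Fin N → ℝ) := funext fun j => by simpa [hb] using hz j
  refine ⟨z, ?_, ?_⟩
  · rintro rfl
    exact hx0 (Subtype.ext (by rw [← hzx]; ext; simp))
  · rw [hzx]
    have h2 : ‖T x‖ < ρ := by simpa [hs] using hxs
    have h3 := pow_lt_pow_left₀ h2 (norm_nonneg _) two_ne_zero
    rw [EuclideanSpace.norm_sq_eq] at h3
    simpa [hT] using h3

end Minkowski

section BinomialPolynomials

/-- The binomial coefficient `binom(x, k)` as a polynomial in `x`. -/
noncomputable def binomialPoly (k : ℕ) : Polynomial ℝ :=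
  Polynomial.C ((k.factorial : ℝ)⁻¹) * descPochhammer ℝ k

lemma eval_binomialPoly_natCast (k m : ℕ) :
    (binomialPoly k).eval (m : ℝ) = (m.choose k : ℝ) := by
  rw [binomialPoly, Polynomial.eval_mul, Polynomial.eval_C, descPochhammer_eval_eq_descFactorial,
    Nat.descFactorial_eq_factorial_mul_choose]
  push_cast
  field_simp

lemma eval_binomialPoly_intCast (k : ℕ) (n : ℤ) :
    (binomialPoly k).eval (n : ℝ) = (Ring.choose n k : ℤ) := by
  have h := Ring.descPochhammer_eq_factorial_smul_choose n k
  rw [← Polynomial.eval_eq_smeval] at h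
  have h' : (descPochhammer ℝ k).eval (n : ℝ) = k.factorial * (Ring.choose n k : ℤ) := by
    rw [← descPochhammer_map (Int.castRingHom ℝ), Polynomial.eval_intCast_map,
      Int.cast_id, h]
    simp
  rw [binomialPoly, Polynomial.eval_mul, Polynomial.eval_C, h']
  field_simp

lemma isIVP_sum_binomialPoly {ι : Type*} (s : Finset ι) (c : ι → ℤ) (k : ι → ℕ) :
    IsIVP (∑ i ∈ s, Polynomial.C (c i : ℝ) * binomialPoly (k i)) := fun n =>
  ⟨∑ i ∈ s, c i * Ring.choose n (k i), by
    simp [Polynomial.eval_finsetSum, eval_binomialPoly_intCast]⟩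

end BinomialPolynomials

section GoldenRatio

open PowerSeries

lemma phi_pos : 0 < phi := by unfold phi; positivity

lemma phi_sq : phi ^ 2 = phi + 1 := by
  unfold phi
  nlinarith [Real.sq_sqrt (show (0 : ℝ) ≤ 5 by norm_num)]

lemma one_lt_phi : 1 < phi := by nlinarith [phi_pos, phi_sq]

lemma phi_inv_add_sq : phi⁻¹ + phi⁻¹ ^ 2 = 1 := by
  have := phi_pos.ne'
  field_simp
  linarith [phi_sq]

lemma abs_phi_inv_lt_one : |phi⁻¹| < 1 := by
  rw [abs_of_pos (inv_pos.2 phi_pos)]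
  exact inv_lt_one_of_one_lt₀ one_lt_phi

lemma coeff_X_pow_mul_geomSeries_pow (r : ℝ) (k m : ℕ) :
    coeff m ((C r * X * geomSeries r) ^ k * geomSeries r) = r ^ m * m.choose k := by
  have e : (C r * X * geomSeries r) ^ k * geomSeries r =
      rescale r (X ^ k * mk fun n => (Nat.choose (k + n) k : ℝ)) := by
    rw [← mk_one_pow_eq_mk_choose_add, map_mul, map_pow, map_pow, rescale_X, geomSeries]
    ring
  rw [e, coeff_rescale, coeff_X_pow_mul']
  split_ifs with h
  · rw [coeff_mk, Nat.add_sub_cancel' h]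
  · rw [Nat.choose_eq_zero_of_lt (not_le.1 h), Nat.cast_zero]

/-- `binom(x, k + 1)` expanded in the basis attached to powers of the Blaschke factor. -/
lemma pow_mul_geomSeries_eq_sum {N k : ℕ} (hk : k < N) :
    (C phi⁻¹ * X * geomSeries phi⁻¹) ^ (k + 1) * geomSeries phi⁻¹ =
      ∑ l : Fin N, C (k.choose l * phi⁻¹ ^ (k - l)) * blaschkeDeriv phi⁻¹ l := by
  set r := phi⁻¹ with hr
  have hr1 : r + r ^ 2 = 1 := phi_inv_add_sq
  have hC : C r + C r ^ 2 = (1 : ℝ⟦X⟧) := by rw [← map_pow, ← map_add, hr1, map_one]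
  have hB : C r * X * geomSeries r = blaschkeSeries r + C r := by
    rw [blaschkeSeries]
    linear_combination C r * one_sub_mul_geomSeries (r := r) + X * geomSeries r * hC
  have hsum : (C r * X * geomSeries r) ^ (k + 1) * geomSeries r =
      ∑ l ∈ Finset.range (k + 1), C (k.choose l * r ^ (k - l)) * blaschkeDeriv r l := by
    rw [pow_succ, hB, add_pow, ← hB, mul_assoc, Finset.sum_mul]
    refine Finset.sum_congr rfl fun l _ => ?_
    rw [blaschkeDeriv, show 1 - r ^ 2 = r by linarith]
    simp only [map_mul, map_pow, map_natCast]
    ring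
  rw [hsum, Fin.sum_univ_eq_sum_range
    (fun l => C (k.choose l * r ^ (k - l)) * blaschkeDeriv r l) N]
  refine Finset.sum_subset (Finset.range_mono hk) fun l _ hl => ?_
  rw [Nat.choose_eq_zero_of_lt (by simpa using hl)]
  simp

/-- The weighted norm of an integral combination of `binom(x, k + 1)`, `k < N`, is bounded by a
quadratic form that is triangular in the coefficients. -/
lemma tsum_sq_eval_sum_binomialPoly_le {N : ℕ} (c : Fin N → ℝ) :
    ∑' n : ℕ, (1 / ((n : ℝ) + 1)) *
        ((∑ i : Fin N, Polynomial.C (c i) * binomialPoly (i + 1)).eval (n : ℝ)) ^ 2 /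
          phi ^ (2 * n) ≤
      ∑ l : Fin N,
        (∑ i : Fin N, c i * ((i : ℕ).choose l * phi⁻¹ ^ ((i : ℕ) - l))) ^ 2 / ((l : ℕ) + 1) := by
  refine le_of_eq_of_le (tsum_congr fun n => ?_) (tsum_sq_coeff_div_le abs_phi_inv_lt_one _)
  have hcoeff : coeff n (∑ l : Fin N, C (∑ i : Fin N, c i *
      ((i : ℕ).choose l * phi⁻¹ ^ ((i : ℕ) - l))) * blaschkeDeriv phi⁻¹ l) =
      phi⁻¹ ^ n * (∑ i : Fin N, Polynomial.C (c i) * binomialPoly (i + 1)).eval (n : ℝ) := by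
    have e : ∑ l : Fin N, C (∑ i : Fin N, c i * ((i : ℕ).choose l * phi⁻¹ ^ ((i : ℕ) - l))) *
        blaschkeDeriv phi⁻¹ l = ∑ i : Fin N, C (c i) *
          ((C phi⁻¹ * X * geomSeries phi⁻¹) ^ ((i : ℕ) + 1) * geomSeries phi⁻¹) := by
      simp only [pow_mul_geomSeries_eq_sum (Fin.is_lt _), map_sum, Finset.sum_mul, Finset.mul_sum]
      rw [Finset.sum_comm]
      simp only [map_mul, mul_assoc]
    rw [e]
    simp only [map_sum, coeff_C_mul, coeff_X_pow_mul_geomSeries_pow,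
      Polynomial.eval_finsetSum, Polynomial.eval_mul, Polynomial.eval_C,
      eval_binomialPoly_natCast, Finset.mul_sum]
    exact Finset.sum_congr rfl fun i _ => by ring
  rw [hcoeff, pow_mul', mul_pow, inv_pow]
  ring

end GoldenRatio

section Existence

lemma prod_fin_sqrt_add_one (N : ℕ) : ∏ i : Fin N, √((i : ℕ) + 1 : ℝ) = √(N.factorial : ℝ) := by
  rw [Fin.prod_univ_eq_prod_range (fun i : ℕ => √((i : ℝ) + 1)) N]
  induction N with
  | zero => simp
  | succ N ih =>
    rw [Finset.prod_range_succ, ih, Nat.factorial_succ, ← Real.sqrt_mul (Nat.cast_nonneg _)]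
    push_cast
    rw [mul_comm]

lemma prod_fin_ite_lt_le {K : ℕ} (hK : 1 ≤ K) (N : ℕ) :
    ∏ i : Fin N, (if (i : ℕ) < K then (K : ℝ) else 1) ≤ (K : ℝ) ^ K := by
  rw [Fin.prod_univ_eq_prod_range (fun i : ℕ => if i < K then (K : ℝ) else 1) N, Finset.prod_ite,
    Finset.prod_const, Finset.prod_const_one, mul_one]
  refine pow_le_pow_right₀ (by exact_mod_cast hK) ?_
  calc _ ≤ (Finset.range K).card := Finset.card_le_card fun i hi => by
        simpa using (Finset.mem_filter.1 hi).2
    _ = K := Finset.card_range K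

/-- In large dimension, balls of squared radius above `2 / π` are big enough for Minkowski's
theorem to apply to lattices of covolume `c / √N!`. -/
lemma exists_two_pow_mul_lt_volume {ε : ℝ} (hε : 0 < ε) (c : ℝ) (hc : 0 < c) :
    ∃ N : ℕ, 2 ^ N * (c / √(N.factorial : ℝ)) <
      √(2 / Real.pi + ε) ^ N * (√Real.pi ^ N / Real.Gamma (N / 2 + 1)) := by
  have hπ := Real.pi_pos
  set q := 1 + Real.pi * ε / 2 with hq
  have hq1 : 1 < q := by rw [hq]; linarith [mul_pos hπ hε]
  obtain ⟨n, hn, hn1⟩ := (((tendsto_pow_const_div_const_pow_of_one_lt 1 hq1).eventually_lt_const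
    (show (0 : ℝ) < 1 / (2 * c) by positivity)).and (Filter.eventually_ge_atTop 1)).exists
  have hn0 : (1 : ℝ) ≤ n := by exact_mod_cast hn1
  have hqn : 2 * n * c < q ^ n := by
    rw [pow_one, div_lt_div_iff₀ (by positivity) (by positivity)] at hn
    linarith
  have hcentral : (4 : ℝ) ^ n * (n.factorial : ℝ) ^ 2 ≤ 2 * n * ((2 * n).factorial : ℝ) := by
    have h1 := Nat.four_pow_le_two_mul_self_mul_centralBinom n hn1
    have h2 : n.centralBinom * n.factorial * n.factorial = (2 * n).factorial := by
      have := Nat.choose_mul_factorial_mul_factorial (show n ≤ 2 * n by omega)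
      rwa [show 2 * n - n = n by omega] at this
    have h3 : 4 ^ n * n.factorial ^ 2 ≤ 2 * n * (2 * n).factorial := by
      rw [← h2]
      calc _ ≤ 2 * n * n.centralBinom * n.factorial ^ 2 := Nat.mul_le_mul_right _ h1
        _ = _ := by ring
    exact_mod_cast h3
  have hfac : (0 : ℝ) < ((2 * n).factorial : ℝ) := by exact_mod_cast Nat.factorial_pos _
  have hfac' : (0 : ℝ) < (n.factorial : ℝ) := by exact_mod_cast Nat.factorial_pos _
  have hs : (0 : ℝ) < √((2 * n).factorial : ℝ) := Real.sqrt_pos.2 hfac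
  have hsqrt : (2 : ℝ) ^ n * n.factorial ≤ 2 * n * √((2 * n).factorial : ℝ) := by
    refine (sq_le_sq₀ (by positivity) (by positivity)).1 ?_
    rw [mul_pow, mul_pow, Real.sq_sqrt hfac.le, ← pow_mul, mul_comm n, pow_mul]
    norm_num
    refine hcentral.trans (mul_le_mul_of_nonneg_right ?_ hfac.le)
    nlinarith
  refine ⟨2 * n, ?_⟩
  have hΓ : Real.Gamma (((2 * n : ℕ) : ℝ) / 2 + 1) = n.factorial := by
    rw [← Real.Gamma_nat_eq_factorial]
    push_cast
    ring_nf
  have hpow : (2 / Real.pi + ε) ^ n * Real.pi ^ n = 2 ^ n * q ^ n := by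
    rw [← mul_pow, ← mul_pow, hq]
    congr 1
    field_simp
  rw [hΓ, pow_mul √(2 / Real.pi + ε), pow_mul √Real.pi, Real.sq_sqrt (by positivity),
    Real.sq_sqrt hπ.le, ← mul_div_assoc, ← mul_div_assoc, hpow,
    div_lt_div_iff₀ hs hfac']
  calc (2 : ℝ) ^ (2 * n) * c * n.factorial = 2 ^ n * c * (2 ^ n * n.factorial) := by
        rw [two_mul, pow_add]; ring
    _ ≤ 2 ^ n * c * (2 * n * √((2 * n).factorial : ℝ)) := by gcongr
    _ = 2 ^ n * (2 * n * c) * √((2 * n).factorial : ℝ) := by ring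
    _ < 2 ^ n * q ^ n * √((2 * n).factorial : ℝ) := by gcongr

lemma sum_binomialPoly_ne_zero {N : ℕ} {c : Fin N → ℝ} (hc : c ≠ 0) :
    ∑ i : Fin N, Polynomial.C (c i) * binomialPoly (i + 1) ≠ 0 := by
  intro h0
  have hzero : ∀ n : ℕ, ∀ i : Fin N, (i : ℕ) = n → c i = 0 := by
    intro n
    induction n using Nat.strong_induction_on with
    | _ n ih =>
      intro i hi
      have h := congrArg (Polynomial.eval ((n + 1 : ℕ) : ℝ)) h0
      simp only [Polynomial.eval_finsetSum, Polynomial.eval_mul, Polynomial.eval_C,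
        eval_binomialPoly_natCast, Polynomial.eval_zero] at h
      rw [Finset.sum_eq_single i (fun j _ hj => ?_) (by simp)] at h
      · simpa [hi] using h
      · rcases lt_or_gt_of_ne (Fin.val_ne_of_ne hj) with hlt | hgt
        · rw [ih j (hi ▸ hlt) j rfl, zero_mul]
        · rw [Nat.choose_eq_zero_of_lt (by omega), Nat.cast_zero, mul_zero]
  exact hc (funext fun i => hzero i i rfl)

/-- For every `K` there is a nonzero integer-valued polynomial of small norm whose values at
`0, …, K` are divisible by `K`. -/
lemma exists_isIVP_small_divisible {ε : ℝ} (hε : 0 < ε) {K : ℕ} (hK : 1 ≤ K) :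
    ∃ P : Polynomial ℝ, P ≠ 0 ∧ IsIVP P ∧
      ∑' n : ℕ, (1 / ((n : ℝ) + 1)) * (P.eval (n : ℝ)) ^ 2 / phi ^ (2 * n)
        ≤ 2 / Real.pi + ε ∧
      ∀ m ≤ K, ∃ t : ℤ, P.eval (m : ℝ) = K * t := by
  have hK0 : (0 : ℝ) < K := by exact_mod_cast hK
  obtain ⟨N, hN⟩ := exists_two_pow_mul_lt_volume hε ((K : ℝ) ^ K) (by positivity)
  let w : Fin N → ℤ := fun i => if (i : ℕ) < K then K else 1
  have hw : ∀ i, (w i : ℝ) = if (i : ℕ) < K then (K : ℝ) else 1 := fun i => by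
    simp only [w]; split_ifs <;> simp
  have hw0 : ∀ i, 0 < (w i : ℝ) := fun i => by rw [hw]; split_ifs <;> simp [hK0]
  let A : Matrix (Fin N) (Fin N) ℝ := Matrix.of fun l i =>
    w i * ((i : ℕ).choose l * phi⁻¹ ^ ((i : ℕ) - l)) / √((l : ℕ) + 1 : ℝ)
  have hdet : A.det = (∏ i, (w i : ℝ)) / √(N.factorial : ℝ) := by
    have htri : A.IsUpperTriangular := fun l i hil => by
      simp [A, Nat.choose_eq_zero_of_lt (show (i : ℕ) < l from hil)]
    rw [Matrix.det_of_isUpperTriangular htri, ← prod_fin_sqrt_add_one, ← Finset.prod_div_distrib]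
    exact Finset.prod_congr rfl fun i _ => by simp [A]
  have hfac : (0 : ℝ) < √(N.factorial : ℝ) :=
    Real.sqrt_pos.2 (by exact_mod_cast Nat.factorial_pos N)
  have hdet0 : 0 < A.det := hdet ▸ div_pos (Finset.prod_pos fun i _ => hw0 i) hfac
  have hdet_le : A.det ≤ (K : ℝ) ^ K / √(N.factorial : ℝ) := by
    rw [hdet]
    gcongr
    simpa only [hw] using prod_fin_ite_lt_le hK N
  obtain ⟨z, hz0, hz⟩ := exists_int_vector_sum_sq_mulVec_lt A hdet0.ne'
    (ρ := √(2 / Real.pi + ε)) (Real.sqrt_pos.2 (by positivity)) (lt_of_le_of_lt (by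
      rw [abs_of_pos hdet0]; gcongr) hN)
  rw [Real.sq_sqrt (by positivity)] at hz
  refine ⟨∑ i : Fin N, Polynomial.C ((w i * z i : ℤ) : ℝ) * binomialPoly (i + 1), ?_,
    isIVP_sum_binomialPoly _ _ _, ?_, fun m hm => ?_⟩
  · refine sum_binomialPoly_ne_zero (c := fun i => ((w i * z i : ℤ) : ℝ)) fun h => hz0 ?_
    funext i
    have := congrFun h i
    simpa [(hw0 i).ne'] using this
  · refine (tsum_sq_eval_sum_binomialPoly_le _).trans (le_of_eq_of_le ?_ hz.le)
    refine Finset.sum_congr rfl fun l _ => ?_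
    rw [← Real.sq_sqrt (show (0 : ℝ) ≤ (l : ℕ) + 1 by positivity), ← div_pow,
      Finset.sum_div, Matrix.mulVec, dotProduct]
    congr 1
    refine Finset.sum_congr rfl fun i _ => ?_
    simp only [A, Matrix.of_apply]
    push_cast
    ring
  · refine ⟨∑ i : Fin N, z i * m.choose (i + 1), ?_⟩
    push_cast
    rw [Polynomial.eval_finsetSum, Finset.mul_sum]
    refine Finset.sum_congr rfl fun i _ => ?_
    rw [← Int.cast_mul, Polynomial.eval_mul, Polynomial.eval_C, eval_binomialPoly_natCast,
      Int.cast_mul, hw]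
    split_ifs with hi
    · ring
    · rw [Nat.choose_eq_zero_of_lt (by omega)]
      simp

end Existence

/-- For every `ε > 0`, there are infinitely many integer-valued polynomials `P`
with `∑_{n≥0} (1/(n+1))·|P(n)|²·φ^{-2n} ≤ 2/π + ε`. -/
theorem stmt_2 (ε : ℝ) (hε : 0 < ε) :
    {P : Polynomial ℝ | IsIVP P ∧
      ∑' n : ℕ, (1 / ((n : ℝ) + 1)) * (P.eval (n : ℝ)) ^ 2 / phi ^ (2 * n)
        ≤ 2 / Real.pi + ε}.Infinite := by
  intro hfin
  have hval : ∀ P : Polynomial ℝ, ∃ k : ℕ, P ≠ 0 →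
      ∃ m ≤ k, P.eval (m : ℝ) ≠ 0 ∧ |P.eval (m : ℝ)| < k := by
    intro P
    by_cases hP : P = 0
    · exact ⟨0, fun h => absurd hP h⟩
    obtain ⟨m, hm⟩ : ∃ m : ℕ, P.eval (m : ℝ) ≠ 0 := by
      by_contra! h
      refine hP (Polynomial.eq_zero_of_infinite_isRoot P
        ((Set.infinite_range_of_injective Nat.cast_injective).mono ?_))
      rintro _ ⟨m, rfl⟩
      exact h m
    obtain ⟨k, hk⟩ := exists_nat_gt |P.eval (m : ℝ)|
    exact ⟨max m k, fun _ => ⟨m, le_max_left _ _, hm, hk.trans_le (by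
      exact_mod_cast le_max_right m k)⟩⟩
  choose k hk using hval
  obtain ⟨K, hK⟩ := (hfin.image k).bddAbove
  obtain ⟨P, hP0, hPI, hPn, hPd⟩ := exists_isIVP_small_divisible hε (K := K + 1) (by omega)
  have hkK : k P ≤ K := hK ⟨P, ⟨hPI, hPn⟩, rfl⟩
  obtain ⟨m, hmk, hm0, hmlt⟩ := hk P hP0
  obtain ⟨t, ht⟩ := hPd m (by omega)
  have ht0 : t ≠ 0 := by
    rintro rfl
    exact hm0 (by simpa using ht)
  have h1 : (1 : ℝ) ≤ |(t : ℝ)| := by exact_mod_cast Int.one_le_abs ht0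
  have h2 : (k P : ℝ) ≤ K := by exact_mod_cast hkK
  rw [ht, abs_mul, Nat.abs_cast] at hmlt
  push_cast at hmlt
  nlinarith
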